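/- arXiv:2202.00404 — 3 statements merged into one kernel-verified Lean document; each statement's English description precedes it below -/
import Mathlib

section
/- For every λ>0, b∈(0,1) and integer n ≥ 1, (1/2π)·∫_0^{2π} K_0(λ·√(1 − 2b·cos θ + b²))·cos(nθ) dθ = I_n(λb)·K_n(λ). -/
open Real MeasureTheory Filter

/-- Modified Bessel function of the first kind `I_n`. -/
noncomputable def besselI (n : ℕ) (x : ℝ) : ℝ :=
  ∑' m : ℕ, (x / 2) ^ (n + 2 * m) / ((Nat.factorial m : ℝ) * (Nat.factorial (n + m) : ℝ))

/-- Modified Bessel function of the second kind `K_n`. -/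
noncomputable def besselK (n : ℕ) (x : ℝ) : ℝ :=
  ∫ t in Set.Ioi (0 : ℝ), Real.exp (-x * Real.cosh t) * Real.cosh ((n : ℝ) * t)

/-- `Λ_n(λ,b) = I_n(λb) K_n(λ)`. -/
noncomputable def Lam (n : ℕ) (l b : ℝ) : ℝ := besselI n (l * b) * besselK n l

/-- `Ω_n(x) = I_1(x)K_1(x) − I_n(x)K_n(x)`. -/
noncomputable def Om (n : ℕ) (x : ℝ) : ℝ :=
  besselI 1 x * besselK 1 x - besselI n x * besselK n x

/-- Discriminant `Δ_n(λ,b)`. -/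
noncomputable def Del (n : ℕ) (l b : ℝ) : ℝ :=
  (b * (Om n l + Om n (l * b)) - (1 + b ^ 2) * Lam 1 l b) ^ 2 - 4 * b ^ 2 * Lam n l b ^ 2

/-- `B_n(λ,b)`. -/
noncomputable def Bfun (n : ℕ) (l b : ℝ) : ℝ :=
  (1 - b ^ 2) * Lam 1 l b + b * (Om n l - Om n (l * b))

/-- `Ω_n^+(λ,b)`. -/
noncomputable def OmP (n : ℕ) (l b : ℝ) : ℝ :=
  (Bfun n l b + Real.sqrt (Del n l b)) / (2 * b)

/-- `Ω_n^−(λ,b)`. -/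
noncomputable def OmM (n : ℕ) (l b : ℝ) : ℝ :=
  (Bfun n l b - Real.sqrt (Del n l b)) / (2 * b)

/-- The matrix `M_n(λ,b,Ω)`. -/
noncomputable def Mmat (n : ℕ) (l b W : ℝ) : Matrix (Fin 2) (Fin 2) ℝ :=
  !![Om n l - W - b * Lam 1 l b, b * Lam n l b;
     -Lam n l b, Lam 1 l b - b * (Om n (l * b) + W)]

lemma integrable_exp_neg_mul_cosh {a : ℝ} (ha : 0 < a) :
    Integrable fun t : ℝ => Real.exp (-a * Real.cosh t) := by
  refine (integrable_exp_neg_mul_sq (by positivity : 0 < a / 4)).mono'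
    (by fun_prop) (.of_forall fun t => ?_)
  rw [Real.norm_of_nonneg (Real.exp_pos _).le, Real.exp_le_exp]
  have h₁ := Real.quadratic_le_exp_of_nonneg (abs_nonneg t)
  have h₂ : Real.cosh t = (Real.exp |t| + Real.exp (-|t|)) / 2 := by
    rw [← Real.cosh_eq, Real.cosh_abs]
  have h₃ : t ^ 2 / 4 ≤ Real.cosh t := by
    nlinarith [sq_abs t, abs_nonneg t, Real.exp_pos (-|t|)]
  nlinarith

lemma integrable_cosh_mul_exp_neg_mul_cosh {a : ℝ} (ha : 0 < a) :
    Integrable fun t : ℝ => Real.cosh t * Real.exp (-a * Real.cosh t) := by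
  refine ((integrable_exp_neg_mul_cosh (half_pos ha)).const_mul (2 / a)).mono'
    (by fun_prop) (.of_forall fun t => ?_)
  have hc := Real.cosh_pos t
  rw [Real.norm_of_nonneg (by positivity)]
  have h : Real.exp (-a * Real.cosh t)
      = Real.exp (-(a / 2) * Real.cosh t) * Real.exp (-(a / 2 * Real.cosh t)) := by
    rw [← Real.exp_add]; ring_nf
  have h₁ : a / 2 * Real.cosh t * Real.exp (-(a / 2 * Real.cosh t)) ≤ 1 := by
    rw [Real.exp_neg, mul_inv_le_iff₀ (Real.exp_pos _)]
    linarith [Real.add_one_le_exp (a / 2 * Real.cosh t)]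
  calc Real.cosh t * Real.exp (-a * Real.cosh t)
      = 2 / a * (Real.exp (-(a / 2) * Real.cosh t)
          * (a / 2 * Real.cosh t * Real.exp (-(a / 2 * Real.cosh t)))) := by
        rw [h]; field_simp
    _ ≤ 2 / a * (Real.exp (-(a / 2) * Real.cosh t) * 1) := by gcongr
    _ = _ := by rw [mul_one]

lemma integral_exp_neg_mul_cosh_mul_cosh (n : ℕ) (x : ℝ) :
    ∫ t : ℝ, Real.exp (-x * Real.cosh t) * Real.cosh (n * t) = 2 * besselK n x := by
  rw [besselK, ← integral_comp_abs (f := fun t => Real.exp (-x * Real.cosh t) * Real.cosh (n * t))]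
  congr 1 with t
  rw [Real.cosh_abs, ← Real.cosh_abs (n * t), abs_mul, Nat.abs_cast]

lemma Complex.cosh_add_mul_I (t α : ℝ) :
    Complex.cosh (t + α * Complex.I)
      = (Real.cosh t * Real.cos α : ℝ) + (Real.sinh t * Real.sin α : ℝ) * Complex.I := by
  rw [Complex.cosh_add, Complex.cosh_mul_I, Complex.sinh_mul_I]
  push_cast
  ring

lemma Complex.re_cosh_add_mul_I (t α : ℝ) :
    (Complex.cosh (t + α * Complex.I)).re = Real.cosh t * Real.cos α := by
  rw [Complex.cosh_add_mul_I]; simp [-Complex.ofReal_mul]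

lemma Complex.norm_sinh_add_mul_I_le (t α : ℝ) :
    ‖Complex.sinh (t + α * Complex.I)‖ ≤ Real.cosh t := by
  rw [Complex.sinh, norm_div, Real.cosh_eq, Complex.norm_two]
  gcongr
  refine (norm_sub_le _ _).trans (le_of_eq ?_)
  simp [Complex.norm_exp]

lemma norm_exp_neg_mul_cosh_add_mul_I (r t α : ℝ) :
    ‖Complex.exp (-r * Complex.cosh (t + α * Complex.I))‖
      = Real.exp (-(r * Real.cos α) * Real.cosh t) := by
  rw [Complex.norm_exp, ← Complex.ofReal_neg, Complex.re_ofReal_mul, Complex.re_cosh_add_mul_I]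
  ring_nf

lemma hasDerivAt_integral_exp_neg_mul_cosh_add_mul_I {r α : ℝ} (hr : 0 < r)
    (hα : |α| < Real.pi / 2) :
    HasDerivAt (fun α : ℝ => ∫ t : ℝ, Complex.exp (-r * Complex.cosh (t + α * Complex.I))) 0 α := by
  obtain ⟨β, hαβ, hβ⟩ := exists_between hα
  have hβ₀ : 0 ≤ β := (abs_nonneg α).trans hαβ.le
  have hc : 0 < Real.cos β := Real.cos_pos_of_mem_Ioo ⟨by linarith [Real.pi_pos], hβ⟩
  have hcα : 0 < Real.cos α := Real.cos_pos_of_mem_Ioo (abs_lt.mp hα)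
  have hint : Integrable fun t : ℝ => Complex.exp (-r * Complex.cosh (t + α * Complex.I)) := by
    refine (integrable_exp_neg_mul_cosh (mul_pos hr hcα)).mono' (by fun_prop) (.of_forall fun t => ?_)
    rw [norm_exp_neg_mul_cosh_add_mul_I]
  have hder (z : ℂ) : HasDerivAt (fun z => Complex.exp (-r * Complex.cosh z))
      (Complex.exp (-r * Complex.cosh z) * (-r * Complex.sinh z)) z :=
    ((Complex.hasDerivAt_cosh z).const_mul (-r : ℂ)).cexp
  obtain ⟨hint', h⟩ := hasDerivAt_integral_of_dominated_loc_of_deriv_le (μ := volume)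
    (F := fun (α t : ℝ) => Complex.exp (-r * Complex.cosh (t + α * Complex.I)))
    (F' := fun (α t : ℝ) => Complex.exp (-r * Complex.cosh (t + α * Complex.I)) *
      (-r * Complex.sinh (t + α * Complex.I)) * Complex.I)
    (bound := fun t => r * (Real.cosh t * Real.exp (-(r * Real.cos β) * Real.cosh t)))
    (x₀ := α) (s := Set.Ioo (-β) β) (Ioo_mem_nhds (abs_lt.mp hαβ).1 (abs_lt.mp hαβ).2)
    (.of_forall fun α => by fun_prop) hint (by fun_prop)
    (.of_forall fun t α' hα' => by
      have hcos : Real.cos β ≤ Real.cos α' := by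
        rw [← Real.cos_abs α']
        exact Real.cos_le_cos_of_nonneg_of_le_pi (abs_nonneg _) (by linarith [Real.pi_pos])
          (abs_lt.mpr hα').le
      rw [norm_mul, norm_mul, norm_mul, norm_exp_neg_mul_cosh_add_mul_I, Complex.norm_I, mul_one,
        norm_neg, Complex.norm_real, Real.norm_of_nonneg hr.le]
      have := Complex.norm_sinh_add_mul_I_le t α'
      have hch := Real.cosh_pos t
      calc _ ≤ Real.exp (-(r * Real.cos β) * Real.cosh t) * (r * Real.cosh t) := by gcongr
        _ = _ := by ring)
    ((integrable_cosh_mul_exp_neg_mul_cosh (mul_pos hr hc)).const_mul r)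
    (.of_forall fun t α' _ => by
      have h₁ : HasDerivAt (fun α : ℝ => (t + α * Complex.I : ℂ)) Complex.I α' := by
        simpa using ((Complex.ofRealCLM.hasDerivAt (x := α')).mul_const Complex.I).const_add (t : ℂ)
      exact (hder _).comp α' h₁)
  refine h.congr_deriv ?_
  rw [integral_mul_const]
  have hint'' : Integrable fun t : ℝ => Complex.exp (-r * Complex.cosh (t + α * Complex.I)) *
      (-r * Complex.sinh (t + α * Complex.I)) := by
    have := hint'.mul_const (-Complex.I)
    simpa [mul_assoc] using this
  rw [integral_eq_zero_of_hasDerivAt_of_integrable (fun t => ?_) hint'' hint, zero_mul]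
  have h₁ : HasDerivAt (fun t : ℝ => (t + α * Complex.I : ℂ)) 1 t := by
    simpa using (Complex.ofRealCLM.hasDerivAt (x := t)).add_const (α * Complex.I : ℂ)
  exact ((hder _).comp t h₁).congr_deriv (mul_one _)

lemma integral_exp_neg_mul_cosh_add_mul_I {r α : ℝ} (hr : 0 < r) (hα : |α| < Real.pi / 2) :
    ∫ t : ℝ, Complex.exp (-r * Complex.cosh (t + α * Complex.I)) = 2 * besselK 0 r := by
  have hd (α : ℝ) (hα : α ∈ Set.Ioo (-(Real.pi / 2)) (Real.pi / 2)) :=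
    hasDerivAt_integral_exp_neg_mul_cosh_add_mul_I hr (abs_lt.mpr hα)
  have h := isOpen_Ioo.is_const_of_deriv_eq_zero isPreconnected_Ioo
    (fun α hα => (hd α hα).differentiableAt.differentiableWithinAt)
    (fun α hα => (hd α hα).deriv) (abs_lt.mp hα) (y := 0) (by simp [Real.pi_pos])
  have h₀ := congrArg Complex.ofReal (integral_exp_neg_mul_cosh_mul_cosh 0 r)
  rw [← integral_complex_ofReal] at h₀
  exact h.trans (by simpa using h₀)

lemma integral_exp_neg_re_mul_cosh_add_im_mul_sinh {p : ℂ} (hp : 0 < p.re) :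
    ∫ t : ℝ, Complex.exp (-(p.re * Real.cosh t + p.im * Real.sinh t * Complex.I))
      = 2 * besselK 0 ‖p‖ := by
  have hp₀ : p ≠ 0 := by rintro rfl; simp at hp
  rw [← integral_exp_neg_mul_cosh_add_mul_I (norm_pos_iff.mpr hp₀)
    (Complex.abs_arg_lt_pi_div_two_iff.mpr (.inl hp))]
  congr 1 with t
  rw [Complex.cosh_add_mul_I]
  have h₁ := Complex.norm_mul_cos_arg p
  have h₂ := Complex.norm_mul_sin_arg p
  rw [← h₁, ← h₂]
  push_cast
  ring_nf

lemma integral_exp_int_mul_I (m : ℤ) :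
    ∫ θ in (0:ℝ)..(2 * Real.pi), Complex.exp (m * Complex.I * θ)
      = if m = 0 then 2 * (Real.pi : ℂ) else 0 := by
  split_ifs with h
  · simp [h]
  · rw [integral_exp_mul_complex (by simp [h])]
    have : (m * Complex.I * (2 * Real.pi : ℝ) : ℂ) = m * (2 * Real.pi * Complex.I) := by
      push_cast; ring
    rw [this, Complex.exp_int_mul_two_pi_mul_I]
    simp

lemma HasSum.mul_fst_snd {f g : ℕ → ℂ} {a b : ℂ} (hf : HasSum f a) (hg : HasSum g b)
    (hf' : Summable fun k => ‖f k‖) (hg' : Summable fun k => ‖g k‖) :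
    HasSum (fun q : ℕ × ℕ => f q.1 * g q.2) (a * b) :=
  hf.mul hg (summable_mul_of_summable_norm hf' hg')

lemma Complex.hasSum_pow_div_factorial (z : ℂ) :
    HasSum (fun k : ℕ => z ^ k / k.factorial) (Complex.exp z) := by
  rw [Complex.exp_eq_exp_ℂ]
  exact NormedSpace.expSeries_div_hasSum_exp z

lemma Complex.summable_norm_pow_div_factorial (z : ℂ) :
    Summable fun k : ℕ => ‖z ^ k / k.factorial‖ :=
  NormedSpace.norm_expSeries_div_summable z

lemma Complex.hasSum_pow_div_mul_pow_div (z w : ℂ) :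
    HasSum (fun q : ℕ × ℕ => z ^ q.1 / q.1.factorial * (w ^ q.2 / q.2.factorial))
      (Complex.exp (z + w)) := by
  rw [Complex.exp_add]
  have h := (hasSum_pow_div_factorial z).mul_fst_snd (hasSum_pow_div_factorial w)
    (summable_norm_pow_div_factorial z) (summable_norm_pow_div_factorial w)
  exact h

lemma hasSum_integral_exp_add_mul_exp (c d : ℂ) (n : ℕ) :
    HasSum (fun m : ℕ => 2 * Real.pi * (c ^ (n + m) / (n + m).factorial * (d ^ m / m.factorial)))
      (∫ θ in (0:ℝ)..(2 * Real.pi),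
        Complex.exp (c * Complex.exp (θ * Complex.I) + d * Complex.exp (-(θ * Complex.I)))
          * Complex.exp (-(n * Complex.I * θ))) := by
  have key : HasSum (fun q : ℕ × ℕ => ∫ θ in (0:ℝ)..(2 * Real.pi),
      ((c * Complex.exp (θ * Complex.I)) ^ q.1 / q.1.factorial)
        * ((d * Complex.exp (-(θ * Complex.I))) ^ q.2 / q.2.factorial)
        * Complex.exp (-(n * Complex.I * θ))) _ :=
    intervalIntegral.hasSum_integral_of_dominated_convergence (μ := volume)
      (a := 0) (b := 2 * Real.pi)
      (f := fun θ : ℝ =>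
        Complex.exp (c * Complex.exp (θ * Complex.I) + d * Complex.exp (-(θ * Complex.I)))
          * Complex.exp (-(n * Complex.I * θ)))
      (fun q _ => ‖c ^ q.1 / q.1.factorial‖ * ‖d ^ q.2 / q.2.factorial‖)
      (fun q => by fun_prop)
      (fun q => .of_forall fun θ _ => by simp [Complex.norm_exp])
      (.of_forall fun θ _ => by
        simpa using (NormedSpace.norm_expSeries_div_summable c).mul_norm
          (NormedSpace.norm_expSeries_div_summable d))
      (by simp)
      (.of_forall fun θ _ => (Complex.hasSum_pow_div_mul_pow_div _ _).mul_right _)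
  have hterm (q : ℕ × ℕ) : ∫ θ in (0:ℝ)..(2 * Real.pi),
      ((c * Complex.exp (θ * Complex.I)) ^ q.1 / q.1.factorial)
        * ((d * Complex.exp (-(θ * Complex.I))) ^ q.2 / q.2.factorial)
        * Complex.exp (-(n * Complex.I * θ))
      = c ^ q.1 / q.1.factorial * (d ^ q.2 / q.2.factorial)
        * (if (q.1 - q.2 - n : ℤ) = 0 then 2 * (Real.pi : ℂ) else 0) := by
    rw [← integral_exp_int_mul_I, ← intervalIntegral.integral_const_mul]
    congr 1 with θ
    have : Complex.exp (((q.1 - q.2 - n : ℤ) : ℂ) * Complex.I * θ)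
        = Complex.exp (θ * Complex.I) ^ q.1 * Complex.exp (-(θ * Complex.I)) ^ q.2
          * Complex.exp (-(n * Complex.I * θ)) := by
      rw [← Complex.exp_nat_mul, ← Complex.exp_nat_mul, ← Complex.exp_add, ← Complex.exp_add]
      push_cast
      ring_nf
    rw [this, mul_pow, mul_pow]
    ring
  simp_rw [hterm] at key
  have hinj : Function.Injective fun m : ℕ => (n + m, m) := fun a b h => (Prod.ext_iff.mp h).2
  rw [← hinj.hasSum_iff] at key
  · convert key using 2 with m
    simp
    ring
  · rintro ⟨j, k⟩ h
    rw [if_neg, mul_zero]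
    intro h₀
    exact h ⟨k, Prod.ext (by simp only at h₀ ⊢; omega) rfl⟩

lemma integral_exp_mul_cosh_mul_exp_neg (n : ℕ) (x t : ℝ) :
    ∫ θ in (0:ℝ)..(2 * Real.pi), Complex.exp (x * Complex.cosh (t + θ * Complex.I))
      * Complex.exp (-(n * Complex.I * θ)) = 2 * Real.pi * (besselI n x * Real.exp (n * t)) := by
  have h := (hasSum_integral_exp_add_mul_exp (x / 2 * Real.exp t) (x / 2 * Real.exp (-t)) n).tsum_eq
  rw [tsum_mul_left] at h
  calc _ = _ := by
        congr 1 with θ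
        rw [Complex.cosh, neg_add, Complex.exp_add, Complex.exp_add (-(t : ℂ))]
        push_cast
        ring_nf
    _ = _ := h.symm
    _ = _ := by
        rw [← Complex.ofReal_mul, besselI, ← tsum_mul_right, Complex.ofReal_tsum]
        congr 2 with m
        have : Real.exp (n * t) = Real.exp t ^ (n + m) * Real.exp (-t) ^ m := by
          rw [← Real.exp_nat_mul, ← Real.exp_nat_mul, ← Real.exp_add]
          push_cast
          ring_nf
        rw [this]
        push_cast
        ring

lemma integral_exp_mul_cosh_mul_cos (n : ℕ) (x t : ℝ) :
    ∫ θ in (0:ℝ)..(2 * Real.pi), Complex.exp (x * Complex.cosh (t + θ * Complex.I))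
      * Real.cos (n * θ) = 2 * Real.pi * (besselI n x * Real.cosh (n * t)) := by
  have h₁ := integral_exp_mul_cosh_mul_exp_neg n x t
  have h₂ : ∫ θ in (0:ℝ)..(2 * Real.pi), Complex.exp (x * Complex.cosh (t + θ * Complex.I))
      * Complex.exp (n * Complex.I * θ) = 2 * Real.pi * (besselI n x * Real.exp (-(n * t))) := by
    have h := integral_exp_mul_cosh_mul_exp_neg n x (-t)
    rw [mul_neg] at h
    rw [← h]
    have hs := intervalIntegral.integral_comp_sub_left (a := 0) (b := 2 * Real.pi)
      (fun θ : ℝ => Complex.exp (x * Complex.cosh (t + θ * Complex.I))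
        * Complex.exp (n * Complex.I * θ)) (2 * Real.pi)
    rw [sub_self, sub_zero] at hs
    rw [← hs]
    congr 1 with θ
    have e₁ : Complex.cosh (t + (2 * Real.pi - θ : ℝ) * Complex.I)
        = Complex.cosh ((-t : ℝ) + θ * Complex.I) := by
      rw [Complex.cosh_add_mul_I, Complex.cosh_add_mul_I]
      simp [Real.cos_two_pi_sub, Real.sin_two_pi_sub]
    have e₂ : Complex.exp (n * Complex.I * (2 * Real.pi - θ : ℝ))
        = Complex.exp (-(n * Complex.I * θ)) := by
      have : (n * Complex.I * (2 * Real.pi - θ : ℝ) : ℂ)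
          = -(n * Complex.I * θ) + n * (2 * Real.pi * Complex.I) := by
        push_cast; ring
      rw [this, Complex.exp_add, Complex.exp_nat_mul_two_pi_mul_I, mul_one]
    rw [e₁, e₂]
  calc _ = ∫ θ in (0:ℝ)..(2 * Real.pi),
        ((Complex.exp (x * Complex.cosh (t + θ * Complex.I)) * Complex.exp (n * Complex.I * θ))
        + (Complex.exp (x * Complex.cosh (t + θ * Complex.I))
          * Complex.exp (-(n * Complex.I * θ)))) / 2 := by
        congr 1 with θ
        rw [Complex.ofReal_cos, Complex.cos]
        push_cast
        ring_nf
    _ = _ := by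
        rw [intervalIntegral.integral_div, intervalIntegral.integral_add, h₁, h₂, Real.cosh_eq]
        · push_cast
          ring
        · exact Continuous.intervalIntegrable (by fun_prop) _ _
        · exact Continuous.intervalIntegrable (by fun_prop) _ _

lemma integrable_exp_mul_cosh_mul_cos {l b : ℝ} (hl : 0 < l) (hb : b ∈ Set.Ioo (0:ℝ) 1) (n : ℕ) :
    Integrable (Function.uncurry fun (θ t : ℝ) => Complex.exp (-(l * Real.cosh t : ℝ)) *
      (Complex.exp ((l * b : ℝ) * Complex.cosh (t + θ * Complex.I)) * Real.cos (n * θ)))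
      ((volume.restrict (Set.uIoc 0 (2 * Real.pi))).prod volume) := by
  have : IsFiniteMeasure (volume.restrict (Set.uIoc 0 (2 * Real.pi))) := by
    unfold Set.uIoc; infer_instance
  refine ((integrable_exp_neg_mul_cosh (mul_pos hl (sub_pos.mpr hb.2))).comp_snd _).mono'
    (Continuous.aestronglyMeasurable (by unfold Function.uncurry; fun_prop))
    (.of_forall fun ⟨θ, t⟩ => ?_)
  simp only [Function.uncurry]
  rw [norm_mul, norm_mul, Complex.norm_exp, Complex.norm_exp, Complex.re_ofReal_mul,
    Complex.re_cosh_add_mul_I, Complex.norm_real, Complex.neg_re, Complex.ofReal_re, ← mul_assoc,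
    ← Real.exp_add]
  have hlb : 0 < l * b := mul_pos hl hb.1
  have hc := Real.cosh_pos t
  have : l * b * (Real.cosh t * Real.cos θ) ≤ l * b * (Real.cosh t * 1) := by
    gcongr
    exact Real.cos_le_one θ
  calc _ ≤ Real.exp (-(l * (1 - b)) * Real.cosh t) * 1 := by
        gcongr
        · linarith
        · exact Real.abs_cos_le_one _
    _ = _ := mul_one _

lemma besselK_zero_mul_sqrt {l b : ℝ} (hl : 0 < l) (hb : b ∈ Set.Ioo (0:ℝ) 1) (θ : ℝ) :
    (2 * besselK 0 (l * Real.sqrt (1 - 2 * b * Real.cos θ + b ^ 2)) : ℂ)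
      = ∫ t : ℝ, Complex.exp (-(l * Real.cosh t : ℝ)) *
        Complex.exp ((l * b : ℝ) * Complex.cosh (t + θ * Complex.I)) := by
  set p : ℂ := ⟨l * (1 - b * Real.cos θ), -(l * b * Real.sin θ)⟩ with hp
  have hre : 0 < p.re := by
    have : b * Real.cos θ ≤ b * 1 := mul_le_mul_of_nonneg_left (Real.cos_le_one θ) hb.1.le
    exact mul_pos hl (by linarith [hb.2])
  have hnorm : ‖p‖ = l * Real.sqrt (1 - 2 * b * Real.cos θ + b ^ 2) := by
    rw [Complex.norm_def, Complex.normSq_mk]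
    conv_rhs => rw [← Real.sqrt_sq hl.le, ← Real.sqrt_mul (sq_nonneg l)]
    congr 1
    linear_combination (l * b) ^ 2 * Real.sin_sq_add_cos_sq θ
  rw [← hnorm, ← integral_exp_neg_re_mul_cosh_add_im_mul_sinh hre]
  congr 1 with t
  rw [← Complex.exp_add, Complex.cosh_add_mul_I, hp]
  push_cast
  ring_nf

/-- `(1/2π)∫_0^{2π} K_0(λ√(1−2b cos θ+b²)) cos(nθ) dθ = I_n(λb) K_n(λ)`. -/
theorem bessel_fourier_coeff (l b : ℝ) (hl : 0 < l) (hb : b ∈ Set.Ioo (0:ℝ) 1)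
    (n : ℕ) (hn : 1 ≤ n) :
    (1 / (2 * Real.pi)) * ∫ θ in (0:ℝ)..(2 * Real.pi),
        besselK 0 (l * Real.sqrt (1 - 2 * b * Real.cos θ + b ^ 2)) * Real.cos (n * θ)
      = besselI n (l * b) * besselK n l := by
  have key : 2 * ∫ θ in (0:ℝ)..(2 * Real.pi),
        besselK 0 (l * Real.sqrt (1 - 2 * b * Real.cos θ + b ^ 2)) * Real.cos (n * θ)
      = 2 * Real.pi * besselI n (l * b) * (2 * besselK n l) := by
    rw [← Complex.ofReal_inj, ← intervalIntegral.integral_const_mul,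
      ← intervalIntegral.integral_ofReal]
    calc _ = ∫ θ in (0:ℝ)..(2 * Real.pi), ∫ t : ℝ, Complex.exp (-(l * Real.cosh t : ℝ)) *
          (Complex.exp ((l * b : ℝ) * Complex.cosh (t + θ * Complex.I)) * Real.cos (n * θ)) := by
          congr 1 with θ
          simp_rw [← mul_assoc]
          rw [integral_mul_const, ← besselK_zero_mul_sqrt hl hb]
          push_cast
          ring
      _ = ∫ t : ℝ, ((2 * Real.pi * besselI n (l * b) *
            (Real.exp (-l * Real.cosh t) * Real.cosh (n * t)) : ℝ) : ℂ) := by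
          rw [intervalIntegral_integral_swap (integrable_exp_mul_cosh_mul_cos hl hb n)]
          congr 1 with t
          rw [intervalIntegral.integral_const_mul, integral_exp_mul_cosh_mul_cos]
          push_cast
          ring_nf
      _ = _ := by
          rw [integral_complex_ofReal, integral_const_mul, integral_exp_neg_mul_cosh_mul_cosh]
  have hpi := Real.pi_ne_zero
  field_simp
  linarith
end

section
/- Let λ>0 and b∈(0,1). There exists N₀∈ℕ, N₀ ≥ 1, such that for every integer n ≥ N₀ one has Δ_n(λ,b) > 0, and for each sign σ∈{+,−} the matrix M_n(λ,b,Ω_n^σ(λ,b)) is singular, i.e. det M_n(λ,b,Ω_n^σ(λ,b)) = 0. -/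
open Real MeasureTheory Filter

open Topology

lemma besselI_term_le {x : ℝ} (hx : 0 ≤ x) (n m : ℕ) :
    (x / 2) ^ (n + 2 * m) / ((Nat.factorial m : ℝ) * (Nat.factorial (n + m) : ℝ)) ≤
      (x / 2) ^ n / (Nat.factorial n : ℝ) * (((x / 2) ^ 2) ^ m / (Nat.factorial m : ℝ)) := by
  have hfac : (Nat.factorial n : ℝ) ≤ (Nat.factorial (n + m) : ℝ) := by
    exact_mod_cast Nat.factorial_le (Nat.le_add_right n m)
  rw [div_mul_div_comm, ← pow_mul, ← pow_add, mul_comm (Nat.factorial n : ℝ)]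
  gcongr

lemma hasSum_besselI_majorant (x : ℝ) (n : ℕ) :
    HasSum (fun m : ℕ => (x / 2) ^ n / (Nat.factorial n : ℝ) *
      (((x / 2) ^ 2) ^ m / (Nat.factorial m : ℝ)))
      ((x / 2) ^ n / (Nat.factorial n : ℝ) * Real.exp ((x / 2) ^ 2)) := by
  have hexp := NormedSpace.expSeries_div_hasSum_exp (𝔸 := ℝ) ((x / 2) ^ 2)
  rw [← Real.exp_eq_exp_ℝ] at hexp
  exact hexp.mul_left _

lemma besselI_summable {x : ℝ} (hx : 0 ≤ x) (n : ℕ) :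
    Summable fun m : ℕ =>
      (x / 2) ^ (n + 2 * m) / ((Nat.factorial m : ℝ) * (Nat.factorial (n + m) : ℝ)) :=
  (hasSum_besselI_majorant x n).summable.of_nonneg_of_le (fun _ => by positivity)
    (besselI_term_le hx n)

lemma besselI_le {x : ℝ} (hx : 0 ≤ x) (n : ℕ) :
    besselI n x ≤ (x / 2) ^ n / (Nat.factorial n : ℝ) * Real.exp ((x / 2) ^ 2) :=
  hasSum_le (besselI_term_le hx n) (besselI_summable hx n).hasSum (hasSum_besselI_majorant x n)

lemma besselI_pos {x : ℝ} (hx : 0 < x) (n : ℕ) : 0 < besselI n x :=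
  (besselI_summable hx.le n).tsum_pos (fun _ => by positivity) 0 (by positivity)

lemma besselI_mul_le {x b : ℝ} (hx : 0 ≤ x) (hb : 0 ≤ b) (hb' : b ≤ 1) (n : ℕ) :
    besselI n (x * b) ≤ b ^ n * besselI n x := by
  unfold besselI
  rw [← tsum_mul_left]
  refine (besselI_summable (mul_nonneg hx hb) n).tsum_le_tsum (fun m => ?_)
    ((besselI_summable hx n).mul_left _)
  rw [mul_div_right_comm x b 2, mul_pow, mul_comm, mul_div_assoc]
  exact mul_le_mul_of_nonneg_right (pow_le_pow_of_le_one hb hb' (Nat.le_add_right _ _))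
    (by positivity)

lemma integral_exp_neg_mul_exp_mul_exp {r : ℝ} (hr : 0 < r) (n : ℕ) :
    ∫ t : ℝ, Real.exp (-(r * Real.exp t)) * Real.exp ((n + 1 : ℕ) * t) =
      (1 / r) ^ (n + 1) * (Nat.factorial n : ℝ) := by
  have hsubst := integral_image_eq_integral_abs_deriv_smul (s := Set.univ) (f := Real.exp)
    (f' := Real.exp) MeasurableSet.univ (fun t _ => (Real.hasDerivAt_exp t).hasDerivWithinAt)
    Real.exp_injective.injOn (fun u => u ^ (((n + 1 : ℕ) : ℝ) - 1) * Real.exp (-(r * u)))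
  rw [Set.image_univ, Real.range_exp, Measure.restrict_univ,
    Real.integral_rpow_mul_exp_neg_mul_Ioi (by positivity) hr, Real.rpow_natCast,
    Nat.cast_add_one, Real.Gamma_nat_eq_factorial] at hsubst
  rw [hsubst]
  congr 1 with t
  rw [abs_of_pos (Real.exp_pos t), smul_eq_mul, add_sub_cancel_right, Real.rpow_natCast,
    ← Real.exp_nat_mul, Nat.cast_add_one, add_one_mul, Real.exp_add]
  ring

lemma integrable_exp_neg_mul_exp_mul_exp {r : ℝ} (hr : 0 < r) (n : ℕ) :
    Integrable fun t : ℝ => Real.exp (-(r * Real.exp t)) * Real.exp ((n + 1 : ℕ) * t) :=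
  .of_integral_ne_zero (by rw [integral_exp_neg_mul_exp_mul_exp hr]; positivity)

lemma besselK_integrand_le {x t : ℝ} (hx : 0 ≤ x) (ht : 0 ≤ t) (n : ℕ) :
    Real.exp (-x * Real.cosh t) * Real.cosh ((n : ℝ) * t) ≤
      Real.exp (-(x / 2 * Real.exp t)) * Real.exp ((n : ℝ) * t) := by
  have hcosh : Real.cosh ((n : ℝ) * t) ≤ Real.exp ((n : ℝ) * t) := by
    have : Real.exp (-((n : ℝ) * t)) ≤ Real.exp ((n : ℝ) * t) := by
      gcongr
      linarith [mul_nonneg n.cast_nonneg ht]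
    rw [Real.cosh_eq]
    linarith
  have hexp : Real.exp t / 2 ≤ Real.cosh t := by
    rw [Real.cosh_eq]
    linarith [Real.exp_pos (-t)]
  gcongr
  nlinarith

lemma besselK_integrableOn {x : ℝ} (hx : 0 < x) (n : ℕ) :
    IntegrableOn (fun t : ℝ => Real.exp (-x * Real.cosh t) * Real.cosh (((n + 1 : ℕ) : ℝ) * t))
      (Set.Ioi 0) := by
  refine (integrable_exp_neg_mul_exp_mul_exp (half_pos hx) n).integrableOn.mono'
    (by fun_prop) ?_
  filter_upwards [ae_restrict_mem measurableSet_Ioi] with t ht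
  rw [Real.norm_of_nonneg (by positivity)]
  exact besselK_integrand_le hx.le (le_of_lt ht) (n + 1)

lemma besselK_succ_le {x : ℝ} (hx : 0 < x) (n : ℕ) :
    besselK (n + 1) x ≤ (2 / x) ^ (n + 1) * (Nat.factorial n : ℝ) := by
  have hint := integrable_exp_neg_mul_exp_mul_exp (half_pos hx) n
  calc besselK (n + 1) x
      ≤ ∫ t in Set.Ioi (0 : ℝ),
          Real.exp (-(x / 2 * Real.exp t)) * Real.exp (((n + 1 : ℕ) : ℝ) * t) :=
        setIntegral_mono_on (besselK_integrableOn hx n) hint.integrableOn measurableSet_Ioi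
          fun t ht => besselK_integrand_le hx.le (le_of_lt ht) (n + 1)
    _ ≤ ∫ t : ℝ, Real.exp (-(x / 2 * Real.exp t)) * Real.exp (((n + 1 : ℕ) : ℝ) * t) :=
        setIntegral_le_integral hint (.of_forall fun t => by positivity)
    _ = (2 / x) ^ (n + 1) * (Nat.factorial n : ℝ) := by
        rw [integral_exp_neg_mul_exp_mul_exp (half_pos hx), one_div_div]

lemma besselK_nonneg (n : ℕ) (x : ℝ) : 0 ≤ besselK n x :=
  integral_nonneg fun t => by positivity

lemma besselK_succ_pos {x : ℝ} (hx : 0 < x) (n : ℕ) : 0 < besselK (n + 1) x := by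
  refine (setIntegral_pos_iff_support_of_nonneg_ae (.of_forall fun t => ?_)
    (besselK_integrableOn hx n)).2 ?_
  · positivity
  · have hsupp : (Function.support fun t : ℝ =>
        Real.exp (-x * Real.cosh t) * Real.cosh (((n + 1 : ℕ) : ℝ) * t)) = Set.univ :=
      Set.eq_univ_of_forall fun t => by
        rw [Function.mem_support]
        positivity
    rw [hsupp]
    simp

lemma besselK_succ_anti {x y : ℝ} (hx : 0 < x) (hxy : x ≤ y) (n : ℕ) :
    besselK (n + 1) y ≤ besselK (n + 1) x := by
  refine setIntegral_mono_on (besselK_integrableOn (hx.trans_le hxy) n)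
    (besselK_integrableOn hx n) measurableSet_Ioi fun t _ => ?_
  have := Real.cosh_pos t
  gcongr

lemma besselI_mul_besselK_succ_le {x : ℝ} (hx : 0 < x) (n : ℕ) :
    besselI (n + 1) x * besselK (n + 1) x ≤ Real.exp ((x / 2) ^ 2) * (1 / ((n : ℝ) + 1)) := by
  calc besselI (n + 1) x * besselK (n + 1) x
      ≤ ((x / 2) ^ (n + 1) / (Nat.factorial (n + 1) : ℝ) * Real.exp ((x / 2) ^ 2)) *
          ((2 / x) ^ (n + 1) * (Nat.factorial n : ℝ)) := by
        gcongr
        · exact besselK_nonneg _ _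
        · exact besselI_le hx.le _
        · exact besselK_succ_le hx n
    _ = Real.exp ((x / 2) ^ 2) * (1 / ((n : ℝ) + 1)) := by
        rw [Nat.factorial_succ, div_pow x, div_pow 2, Nat.cast_mul, Nat.cast_add_one]
        have := Nat.factorial_pos n
        field_simp

lemma tendsto_besselI_mul_besselK {x : ℝ} (hx : 0 < x) :
    Tendsto (fun n => besselI n x * besselK n x) atTop (𝓝 0) := by
  rw [← tendsto_add_atTop_iff_nat 1]
  refine squeeze_zero (fun n => mul_nonneg (besselI_pos hx _).le (besselK_nonneg _ _))
    (besselI_mul_besselK_succ_le hx) ?_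
  simpa using (tendsto_one_div_add_atTop_nhds_zero_nat (𝕜 := ℝ)).const_mul
    (Real.exp ((x / 2) ^ 2))

lemma tendsto_Om {x : ℝ} (hx : 0 < x) :
    Tendsto (fun n => Om n x) atTop (𝓝 (besselI 1 x * besselK 1 x)) := by
  simpa [Om] using (tendsto_besselI_mul_besselK hx).const_sub (besselI 1 x * besselK 1 x)

lemma tendsto_Lam {l b : ℝ} (hl : 0 < l) (hb : 0 < b) (hb' : b ≤ 1) :
    Tendsto (fun n => Lam n l b) atTop (𝓝 0) := by
  refine squeeze_zero
    (fun n => mul_nonneg (besselI_pos (mul_pos hl hb) n).le (besselK_nonneg n l))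
    (fun n => mul_le_mul_of_nonneg_right ?_ (besselK_nonneg n l)) (tendsto_besselI_mul_besselK hl)
  exact (besselI_mul_le hl.le hb.le hb' n).trans
    (mul_le_of_le_one_left (besselI_pos hl n).le (pow_le_one₀ hb.le hb'))

lemma one_add_sq_mul_Lam_one_lt {l b : ℝ} (hl : 0 < l) (hb : 0 < b) (hb' : b < 1) :
    (1 + b ^ 2) * Lam 1 l b <
      b * (besselI 1 l * besselK 1 l + besselI 1 (l * b) * besselK 1 (l * b)) := by
  have hI : besselI 1 (l * b) ≤ b * besselI 1 l := by
    simpa using besselI_mul_le hl.le hb.le hb'.le 1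
  have hIK := mul_le_mul_of_nonneg_right hI (besselK_nonneg 1 l)
  have hK := mul_le_mul_of_nonneg_left
    (besselK_succ_anti (mul_pos hl hb) (mul_le_of_le_one_right hl.le hb'.le) 0)
    (mul_pos hb (besselI_pos (mul_pos hl hb) 1)).le
  have hLam : 0 < Lam 1 l b := mul_pos (besselI_pos (mul_pos hl hb) 1) (besselK_succ_pos hl 0)
  have hsq : b ^ 2 * Lam 1 l b < b * Lam 1 l b := by
    gcongr
    nlinarith
  simp only [Lam, zero_add] at *
  linarith

lemma tendsto_Del {l b : ℝ} (hl : 0 < l) (hb : 0 < b) (hb' : b ≤ 1) :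
    Tendsto (fun n => Del n l b) atTop
      (𝓝 ((b * (besselI 1 l * besselK 1 l + besselI 1 (l * b) * besselK 1 (l * b)) -
        (1 + b ^ 2) * Lam 1 l b) ^ 2)) := by
  simpa [Del] using
    (((((tendsto_Om hl).add (tendsto_Om (mul_pos hl hb))).const_mul b).sub_const
      ((1 + b ^ 2) * Lam 1 l b)).pow 2).sub
      (((tendsto_Lam hl hb hb').pow 2).const_mul (4 * b ^ 2))

lemma four_mul_det_Mmat (n : ℕ) (l b W : ℝ) :
    4 * b * (Mmat n l b W).det = (2 * b * W - Bfun n l b) ^ 2 - Del n l b := by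
  rw [Mmat, Matrix.det_fin_two_of, Bfun, Del]
  ring

lemma det_Mmat_eq_zero {n : ℕ} {l b W : ℝ} (hb : b ≠ 0)
    (hW : (2 * b * W - Bfun n l b) ^ 2 = Del n l b) : (Mmat n l b W).det = 0 := by
  have := four_mul_det_Mmat n l b W
  rw [hW, sub_self] at this
  exact (mul_eq_zero.1 this).resolve_left (mul_ne_zero four_ne_zero hb)

/-- existence of the eigenvalues: for `n` large `Δ_n(λ,b) > 0` and the
matrix `M_n(λ,b,Ω_n^±(λ,b))` is singular. -/
theorem eigenvalues_exist (l b : ℝ) (hl : 0 < l) (hb : b ∈ Set.Ioo (0:ℝ) 1) :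
    ∃ N₀ : ℕ, 1 ≤ N₀ ∧ ∀ n : ℕ, N₀ ≤ n →
      0 < Del n l b ∧
      (Mmat n l b (OmP n l b)).det = 0 ∧
      (Mmat n l b (OmM n l b)).det = 0 := by
  obtain ⟨hb0, hb1⟩ := hb
  have hlim := sub_pos.2 (one_add_sq_mul_Lam_one_lt hl hb0 hb1)
  obtain ⟨N, hN⟩ := eventually_atTop.1
    ((tendsto_Del hl hb0 hb1.le).eventually_const_lt (pow_pos hlim 2))
  refine ⟨max 1 N, le_max_left _ _, fun n hn => ?_⟩
  have hDel := hN n ((le_max_right _ _).trans hn)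
  refine ⟨hDel, det_Mmat_eq_zero hb0.ne' ?_, det_Mmat_eq_zero hb0.ne' ?_⟩
  · rw [OmP, mul_div_cancel₀ _ (by positivity), add_sub_cancel_left, Real.sq_sqrt hDel.le]
  · rw [OmM, mul_div_cancel₀ _ (by positivity), sub_sub_cancel_left, neg_sq, Real.sq_sqrt hDel.le]
end

section
/- For every λ>0 and every integer n ≥ 2, | I_n(λ)·K_n(λ) − 1/(2n) | ≤ λ². -/
open Real MeasureTheory Filter

theorem integrableOn_pow_mul_exp_neg (k : ℕ) :
    IntegrableOn (fun u : ℝ => u ^ k * exp (-u)) (Set.Ioi 0) := by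
  have h := Real.GammaIntegral_convergent (s := (k : ℝ) + 1) (by positivity)
  refine h.congr_fun (fun u _ => ?_) measurableSet_Ioi
  simp [mul_comm]

theorem integral_pow_mul_exp_neg (k : ℕ) :
    ∫ u in Set.Ioi (0 : ℝ), u ^ k * exp (-u) = (k.factorial : ℝ) := by
  rw [← Real.Gamma_nat_eq_factorial, Real.Gamma_eq_integral (by positivity)]
  refine setIntegral_congr_fun measurableSet_Ioi (fun u _ => ?_)
  simp [mul_comm]

/-- The integrand of the gamma-type representation of `K_{k+1}(2√z)`. -/
noncomputable def besselKernel (k : ℕ) (z u : ℝ) : ℝ := u ^ k * exp (-u - z / u)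

theorem integrableOn_besselKernel (k : ℕ) {z : ℝ} (hz : 0 ≤ z) :
    IntegrableOn (besselKernel k z) (Set.Ioi 0) := by
  refine Integrable.mono' (integrableOn_pow_mul_exp_neg k) ?_ ?_
  · unfold besselKernel
    exact Measurable.aestronglyMeasurable (by fun_prop)
  · refine (ae_restrict_iff' measurableSet_Ioi).2 (ae_of_all _ fun u (hu : 0 < u) => ?_)
    have : 0 ≤ z / u := by positivity
    rw [besselKernel, Real.norm_of_nonneg (by positivity)]
    gcongr
    linarith

theorem integral_besselKernel_nonneg (k : ℕ) (z : ℝ) :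
    0 ≤ ∫ u in Set.Ioi (0 : ℝ), besselKernel k z u :=
  setIntegral_nonneg measurableSet_Ioi fun u (hu : 0 < u) => by
    unfold besselKernel; positivity

theorem pow_mul_integral_besselKernel_le (k j : ℕ) {z : ℝ} (hz : 0 ≤ z) :
    z ^ j * ∫ u in Set.Ioi (0 : ℝ), besselKernel k z u ≤
      (j.factorial : ℝ) * ((k + j).factorial : ℝ) := by
  rw [← integral_pow_mul_exp_neg (k + j), ← integral_const_mul, ← integral_const_mul]
  refine setIntegral_mono_on ((integrableOn_besselKernel k hz).const_mul _)
    ((integrableOn_pow_mul_exp_neg _).const_mul _) measurableSet_Ioi fun u (hu : 0 < u) => ?_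
  have h := Real.pow_div_factorial_le_exp (z / u) (by positivity) j
  rw [div_le_iff₀ (by positivity), div_pow, div_le_iff₀ (by positivity)] at h
  calc z ^ j * besselKernel k z u
      ≤ (exp (z / u) * j.factorial * u ^ j) * besselKernel k z u := by
        unfold besselKernel; gcongr
    _ = j.factorial * (u ^ (k + j) * (exp (z / u) * exp (-u - z / u))) := by
        unfold besselKernel; ring
    _ = j.factorial * (u ^ (k + j) * exp (-u)) := by
        rw [← Real.exp_add]; ring_nf

theorem le_integral_besselKernel (k : ℕ) {z : ℝ} (hz : 0 ≤ z) :
    ((k + 1).factorial : ℝ) - z * (k.factorial : ℝ) ≤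
      ∫ u in Set.Ioi (0 : ℝ), besselKernel (k + 1) z u := by
  rw [← integral_pow_mul_exp_neg (k + 1), ← integral_pow_mul_exp_neg k, ← integral_const_mul,
    ← integral_sub (integrableOn_pow_mul_exp_neg _) ((integrableOn_pow_mul_exp_neg _).const_mul _)]
  refine setIntegral_mono_on ((integrableOn_pow_mul_exp_neg _).sub
    ((integrableOn_pow_mul_exp_neg _).const_mul _)) (integrableOn_besselKernel _ hz)
    measurableSet_Ioi fun u (hu : 0 < u) => ?_
  have h := Real.add_one_le_exp (-(z / u))
  calc u ^ (k + 1) * exp (-u) - z * (u ^ k * exp (-u))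
      = u ^ (k + 1) * (exp (-u) * (-(z / u) + 1)) := by field_simp; ring
    _ ≤ u ^ (k + 1) * (exp (-u) * exp (-(z / u))) := by gcongr
    _ = besselKernel (k + 1) z u := by
        rw [besselKernel, ← Real.exp_add, ← sub_eq_add_neg]

theorem mul_besselKernel_mul_exp (k : ℕ) {x : ℝ} (hx : 0 < x) (t : ℝ) :
    |x / 2 * exp t| • besselKernel k (x ^ 2 / 4) (x / 2 * exp t) =
      (x / 2) ^ (k + 1) * exp (-x * cosh t + (k + 1 : ℕ) * t) := by
  have hcosh : -(x / 2 * exp t) - x ^ 2 / 4 / (x / 2 * exp t) = -x * cosh t := by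
    rw [Real.cosh_eq, Real.exp_neg]
    field_simp
    ring
  rw [abs_of_pos (by positivity), smul_eq_mul, besselKernel, hcosh, Real.exp_add,
    Real.exp_nat_mul]
  ring

theorem image_const_mul_exp {c : ℝ} (hc : 0 < c) :
    (fun t => c * exp t) '' Set.univ = Set.Ioi 0 := by
  ext u
  simp only [Set.image_univ, Set.mem_range, Set.mem_Ioi]
  constructor
  · rintro ⟨t, rfl⟩
    positivity
  · intro hu
    exact ⟨log (u / c), by rw [Real.exp_log (by positivity)]; field_simp⟩

theorem besselK_eq_integral_besselKernel (k : ℕ) {x : ℝ} (hx : 0 < x) :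
    2 * (x / 2) ^ (k + 1) * besselK (k + 1) x =
      ∫ u in Set.Ioi (0 : ℝ), besselKernel k (x ^ 2 / 4) u := by
  have hderiv : ∀ t ∈ Set.univ, HasDerivWithinAt (fun t => x / 2 * exp t) (x / 2 * exp t)
      Set.univ t := fun t _ => ((Real.hasDerivAt_exp t).const_mul _).hasDerivWithinAt
  have hinj : Set.InjOn (fun t => x / 2 * exp t) Set.univ := fun a _ b _ hab =>
    Real.exp_injective (mul_left_cancel₀ (by positivity) hab)
  set g : ℝ → ℝ := fun t => exp (-x * cosh t + (k + 1 : ℕ) * t) with hg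
  have hg_int : Integrable g := by
    have h := (integrableOn_image_iff_integrableOn_abs_deriv_smul MeasurableSet.univ hderiv hinj
      (besselKernel k (x ^ 2 / 4))).1
      (by rw [image_const_mul_exp (by positivity)]; exact integrableOn_besselKernel k (by positivity))
    simp_rw [mul_besselKernel_mul_exp k hx] at h
    rw [integrableOn_univ] at h
    exact (integrable_const_mul_iff (IsUnit.mk0 _ (by positivity)) _).1 h
  have hsubst := integral_image_eq_integral_abs_deriv_smul MeasurableSet.univ hderiv hinj
    (besselKernel k (x ^ 2 / 4))
  simp_rw [mul_besselKernel_mul_exp k hx] at hsubst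
  rw [image_const_mul_exp (by positivity), setIntegral_univ, integral_const_mul] at hsubst
  have hneg : ∫ t in Set.Ioi (0 : ℝ), g (-t) = ∫ t in Set.Iic (0 : ℝ), g t := by
    simp [integral_comp_neg_Ioi 0 g]
  have hfold : 2 * besselK (k + 1) x = ∫ t, g t := by
    rw [← intervalIntegral.integral_Iic_add_Ioi hg_int.integrableOn hg_int.integrableOn (b := 0),
      ← hneg, ← integral_add hg_int.comp_neg.integrableOn hg_int.integrableOn, besselK,
      ← integral_const_mul]
    refine setIntegral_congr_fun measurableSet_Ioi fun t _ => ?_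
    simp only [hg, Real.cosh_neg, Real.exp_add, Real.cosh_eq ((k + 1 : ℕ) * t), mul_neg]
    ring
  rw [hsubst, ← hfold]
  ring

theorem besselI_eq_pow_mul_tsum (n : ℕ) (x : ℝ) :
    besselI n x = (x / 2) ^ n *
      ∑' m : ℕ, (x ^ 2 / 4) ^ m / ((m.factorial : ℝ) * ((n + m).factorial : ℝ)) := by
  rw [besselI, ← tsum_mul_left]
  refine tsum_congr fun m => ?_
  rw [pow_add, pow_mul, mul_div_assoc]
  ring_nf

theorem besselI_mul_besselK (k : ℕ) {x : ℝ} (hx : 0 < x) :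
    besselI (k + 1) x * besselK (k + 1) x =
      (∑' m : ℕ, (x ^ 2 / 4) ^ m / ((m.factorial : ℝ) * ((k + 1 + m).factorial : ℝ)) *
        ∫ u in Set.Ioi (0 : ℝ), besselKernel k (x ^ 2 / 4) u) / 2 := by
  rw [tsum_mul_right, ← besselK_eq_integral_besselKernel k hx, besselI_eq_pow_mul_tsum]
  ring

/-- Partial sums of the series for `2 I_{k+2}(2√z) K_{k+2}(2√z)`, with the tail telescoped. -/
theorem sum_range_mul_integral_besselKernel_le (k N : ℕ) {z : ℝ} (hz : 0 ≤ z) :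
    ∑ m ∈ Finset.range (N + 1), z ^ m / ((m.factorial : ℝ) * ((k + 1 + 1 + m).factorial : ℝ)) *
        ∫ u in Set.Ioi (0 : ℝ), besselKernel (k + 1) z u ≤
      1 / ((k + 2 : ℕ) : ℝ) + z * (1 - 1 / (N + 1)) := by
  induction N with
  | zero =>
    have h := pow_mul_integral_besselKernel_le (k + 1) 0 hz
    simp only [pow_zero, one_mul, Nat.factorial_zero, Nat.cast_one, add_zero] at h
    have hfac : ((k + 2).factorial : ℝ) = (k + 2 : ℕ) * ((k + 1).factorial : ℝ) := by
      exact_mod_cast Nat.factorial_succ (k + 1)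
    simp only [zero_add, Finset.sum_range_one, pow_zero, Nat.factorial_zero, Nat.cast_one,
      add_zero, one_mul, Nat.cast_zero, div_one, sub_self, mul_zero]
    rw [show k + 1 + 1 = k + 2 from rfl, hfac, one_div_mul_eq_div, div_le_div_iff₀ (by positivity)
      (by positivity)]
    nlinarith [Nat.cast_nonneg (α := ℝ) (k + 2)]
  | succ N ih =>
    rw [Finset.sum_range_succ]
    have h := pow_mul_integral_besselKernel_le (k + 1) N hz
    have hfac : ((k + 1 + 1 + (N + 1)).factorial : ℝ) =
        (k + N + 3) * ((k + N + 2) * ((k + 1 + N).factorial : ℝ)) := by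
      rw [show k + 1 + 1 + (N + 1) = k + 1 + N + 1 + 1 by ring, Nat.factorial_succ,
        Nat.factorial_succ]
      push_cast
      ring
    have hterm : z ^ (N + 1) / (((N + 1).factorial : ℝ) * ((k + 1 + 1 + (N + 1)).factorial : ℝ)) *
        ∫ u in Set.Ioi (0 : ℝ), besselKernel (k + 1) z u ≤ z * (1 / ((N + 1) * (N + 2))) := by
      rw [hfac, Nat.factorial_succ]
      push_cast
      calc _ = z / ((N + 1) * ((k + N + 3) * (k + N + 2))) *
            ((z ^ N * ∫ u in Set.Ioi (0 : ℝ), besselKernel (k + 1) z u) /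
              (N.factorial * (k + 1 + N).factorial)) := by
            rw [pow_succ]; field_simp
        _ ≤ z / ((N + 1) * ((k + N + 3) * (k + N + 2))) * 1 := by
            gcongr
            exact (div_le_one (by positivity)).2 h
        _ ≤ z / ((N + 1) * (1 * (N + 2))) * 1 := by
            gcongr <;> linarith [Nat.cast_nonneg (α := ℝ) k, Nat.cast_nonneg (α := ℝ) N]
        _ = _ := by ring
    refine (add_le_add ih hterm).trans (le_of_eq ?_)
    push_cast
    field_simp
    ring

/-- `|I_n(λ)K_n(λ) − 1/(2n)| ≤ λ²` for all `λ > 0` and `n ≥ 2`. -/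
theorem besselIK_approx (l : ℝ) (hl : 0 < l) (n : ℕ) (hn : 2 ≤ n) :
    |besselI n l * besselK n l - 1 / (2 * n)| ≤ l ^ 2 := by
  obtain ⟨k, rfl⟩ : ∃ k, n = k + 1 + 1 := ⟨n - 2, by omega⟩
  rw [besselI_mul_besselK (k + 1) hl]
  obtain ⟨z, hz⟩ : ∃ z, z = l ^ 2 / 4 := ⟨_, rfl⟩
  have hz0 : 0 ≤ z := by rw [hz]; positivity
  rw [← hz]
  set J := ∫ u in Set.Ioi (0 : ℝ), besselKernel (k + 1) z u with hJ
  have hJ0 : 0 ≤ J := integral_besselKernel_nonneg _ _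
  set a : ℕ → ℝ := fun m => z ^ m / ((m.factorial : ℝ) * ((k + 1 + 1 + m).factorial : ℝ)) * J
    with ha
  have ha0 : ∀ m, 0 ≤ a m := fun m => by positivity
  have hsum : ∀ N, ∑ m ∈ Finset.range N, a m ≤ 1 / ((k + 2 : ℕ) : ℝ) + z := fun N => by
    refine (Finset.sum_le_sum_of_subset_of_nonneg (Finset.range_mono N.le_succ)
      fun m _ _ => ha0 m).trans ((sum_range_mul_integral_besselKernel_le k N hz0).trans ?_)
    have : 0 ≤ z * (1 / ((N : ℝ) + 1)) := by positivity
    linarith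
  have hupper := Real.tsum_le_of_sum_range_le ha0 hsum
  have hlower := (summable_of_sum_range_le ha0 hsum).le_tsum 0 fun m _ => ha0 m
  have hJle : ((k + 1).factorial : ℝ) - z * (k.factorial : ℝ) ≤ J :=
    le_integral_besselKernel k hz0
  have hzero : 1 / ((k + 2 : ℕ) : ℝ) - z ≤ a 0 := by
    have hfac : ((k + 1 + 1).factorial : ℝ) = (k + 2) * ((k + 1) * (k.factorial : ℝ)) := by
      rw [Nat.factorial_succ, Nat.factorial_succ]
      push_cast
      ring
    rw [Nat.factorial_succ] at hJle
    push_cast at hJle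
    simp only [ha, pow_zero, Nat.factorial_zero, Nat.cast_one, one_mul, add_zero, hfac]
    rw [one_div_mul_eq_div, le_div_iff₀ (by positivity)]
    refine le_trans ?_ hJle
    push_cast
    have h1 : (1 / ((k : ℝ) + 2) - z) * ((k + 2) * ((k + 1) * (k.factorial : ℝ))) =
        (k + 1) * k.factorial - z * k.factorial * ((k + 2) * (k + 1)) := by
      field_simp
    rw [h1]
    have h2 : z * k.factorial * 1 ≤ z * k.factorial * (((k : ℝ) + 2) * (k + 1)) := by
      gcongr
      nlinarith [Nat.cast_nonneg (α := ℝ) k]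
    linarith
  have hhalf : 1 / (2 * ((k + 1 + 1 : ℕ) : ℝ)) = 1 / ((k + 2 : ℕ) : ℝ) / 2 := by
    rw [div_div, mul_comm]
  rw [hhalf, abs_le]
  constructor <;> nlinarith
end
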